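/- Every n-player action-dependent risk-averse matrix game admits a risk-averse Nash equilibrium. Precisely: suppose for each player i the penalty function D_i : P_{−i} × P_{−i} → ℝ is jointly continuous and is convex in its first argument for each fixed second argument, and define the action-dependent risk-averse loss f_i(π_i, π_{−i}) = Σ_{j=1}^{A_i} π_i(j) · sup_{p ∈ P_{−i}} ( −⟨R_{i,j}, p⟩ − D_i(p, π_{−i}) ), where R_{i,j} ∈ ℝ^{A_{−i}} is the j-th row of R_i. Then there exists a joint strategy π* ∈ P such that for every player i and every π_i ∈ Δ_{A_i}, f_i(π_i*, π_{−i}*) ≤ f_i(π_i, π_{−i}*). -/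

import Mathlib

open Finset

/-- The space of (concatenations of) opponents' strategy profiles of player `i`. -/
abbrev OppProfile (n : ℕ) (A : Fin n → ℕ) (i : Fin n) : Type :=
  ∀ j : {j : Fin n // j ≠ i}, Fin (A j.1) → ℝ

/-- `P_{−i} = ∏_{j ≠ i} Δ_{A_j}`, the product of the opponents' simplices. -/
def OppSimplex (n : ℕ) (A : Fin n → ℕ) (i : Fin n) : Set (OppProfile n A i) :=
  {p | ∀ j, p j ∈ stdSimplex ℝ (Fin (A j.1))}

/-- Index set for the concatenation `ℝ^{A_{−i}}`, `A_{−i} = Σ_{j≠i} A_j`. -/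
abbrev OppIdx (n : ℕ) (A : Fin n → ℕ) (i : Fin n) : Type :=
  Σ j : {j : Fin n // j ≠ i}, Fin (A j.1)

/-- The inner product `⟨R_{i,j}, p⟩` of the `j`-th row of `R_i` with
`p ∈ P_{−i} ⊆ ℝ^{A_{−i}}` (viewed by concatenation). -/
def rowPair (n : ℕ) (A : Fin n → ℕ) (i : Fin n)
    (Rrow : OppIdx n A i → ℝ) (p : OppProfile n A i) : ℝ :=
  ∑ b : OppIdx n A i, Rrow b * p b.1 b.2

/-- The restriction `π_{−i}` of a joint strategy profile `π` to the opponents of `i`. -/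
def restr (n : ℕ) (A : Fin n → ℕ) (π : ∀ j, Fin (A j) → ℝ) (i : Fin n) :
    OppProfile n A i := fun j => π j.1

/-- The action-dependent risk-averse loss
`f_i(π_i, π_{−i}) = Σ_j π_i(j) · sup_{p ∈ P_{−i}} ( −⟨R_{i,j}, p⟩ − D_i(p, π_{−i}) )`. -/
noncomputable def actLoss (n : ℕ) (A : Fin n → ℕ)
    (R : ∀ i : Fin n, Fin (A i) → OppIdx n A i → ℝ)
    (D : ∀ i : Fin n, OppProfile n A i → OppProfile n A i → ℝ)
    (i : Fin n) (π : ∀ j, Fin (A j) → ℝ) : ℝ :=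
  ∑ a : Fin (A i), π i a *
    sSup ((fun p => -(rowPair n A i (R i a) p) - D i p (restr n A π i)) ''
      OppSimplex n A i)

section ScarfAbstract

set_option linter.unusedSectionVars false

variable {I Y : Type} [Fintype I] [DecidableEq I] [Fintype Y] [DecidableEq Y]

/-- Scarf dominance. -/
def ScDom (h : I → Y → ℕ) (s : Finset Y) : Prop := ∀ y, ∃ i, ∀ x ∈ s, h i y ≤ h i x

/-- `x` is the `k`-greatest element of the set of `y` above all the other minima. -/
def ScMax (h : I → Y → ℕ) (m : I → Y) (k : I) (x : Y) : Prop :=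
  (∀ i, i ≠ k → h i (m i) < h i x) ∧
    ∀ y, (∀ i, i ≠ k → h i (m i) < h i y) → h k y ≤ h k x

lemma sc_struct (h : I → Y → ℕ) (hinj : ∀ i, Function.Injective (h i)) (s : Finset Y)
    (hs : s.Nonempty) (hd : ScDom h s) (hc : s.card + 1 = Fintype.card I) :
    ∃ (m : I → Y) (i1 i2 : I), i1 ≠ i2 ∧ m i1 = m i2 ∧ (∀ i, m i ∈ s) ∧
      (∀ i, ∀ x ∈ s, h i (m i) ≤ h i x) ∧
      (∀ i j, i ≠ i1 → j ≠ i1 → m i = m j → i = j) ∧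
      (∀ i j, i ≠ i2 → j ≠ i2 → m i = m j → i = j) := by
  choose m hm hmin using fun i => Finset.exists_min_image s (h i) hs
  have hsurj : ∀ y ∈ s, ∃ i, m i = y := by
    intro y hy
    obtain ⟨i, hi⟩ := hd y
    exact ⟨i, hinj i (le_antisymm (hmin i y hy) (hi _ (hm i)))⟩
  have key : ∀ a b : I, a ≠ b → m a = m b →
      ∀ i j, i ≠ a → j ≠ a → m i = m j → i = j := by
    intro a b hab hmab
    have hsu : Set.SurjOn m (Finset.univ.erase a : Finset I) s := by
      intro y hy
      obtain ⟨i, hi⟩ := hsurj y hy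
      by_cases hia : i = a
      · exact ⟨b, by simpa using hab.symm, by rw [← hmab, ← hia, hi]⟩
      · exact ⟨i, by simpa using hia, hi⟩
    have hin := Finset.injOn_of_surjOn_of_card_le m (s := Finset.univ.erase a) (t := s)
      (fun i _ => hm i) hsu (by
        rw [Finset.card_erase_of_mem (Finset.mem_univ _), Finset.card_univ]; omega)
    intro i j hi hj hij
    exact hin (by simpa using hi) (by simpa using hj) hij
  obtain ⟨i1, -, i2, -, hne, heq⟩ := Finset.exists_ne_map_eq_of_card_lt_of_maps_to
    (s := (Finset.univ : Finset I)) (t := s) (by rw [Finset.card_univ]; omega)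
    (f := m) (fun i _ => hm i)
  exact ⟨m, i1, i2, hne, heq, hm, hmin, key i1 i2 hne heq, key i2 i1 hne.symm heq.symm⟩

lemma sc_fwd (h : I → Y → ℕ) (hinj : ∀ i, Function.Injective (h i)) (s : Finset Y)
    (m : I → Y) (hm : ∀ i, m i ∈ s)
    (hmin : ∀ i, ∀ x ∈ s, h i (m i) ≤ h i x) (k : I)
    (hk : ∀ i j, i ≠ k → j ≠ k → m i = m j → i = j)
    (x : Y) (hx : x ∉ s) (hd : ScDom h (insert x s)) (hkx : ∀ y ∈ s, h k x ≤ h k y) :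
    ScMax h m k x := by
  refine ⟨?_, ?_⟩
  · intro i hi
    obtain ⟨k', hk'⟩ := hd (m i)
    have h1 : m i = m k' := hinj k' (le_antisymm
      (hk' _ (Finset.mem_insert_of_mem (hm k'))) (hmin _ _ (hm i)))
    have h2 : k' ≠ k := by
      rintro rfl
      have : x = m i := hinj k' (le_antisymm (hkx _ (hm i)) (hk' _ (Finset.mem_insert_self _ _)))
      exact hx (this ▸ hm i)
    have h3 := hk i k' hi h2 h1
    subst h3
    refine lt_of_le_of_ne (hk' _ (Finset.mem_insert_self _ _)) ?_
    intro he
    exact hx (hinj i he ▸ hm i)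
  · intro y hy
    obtain ⟨i, hi⟩ := hd y
    by_cases hik : i = k
    · subst hik; exact hi _ (Finset.mem_insert_self _ _)
    · exact absurd (hi _ (Finset.mem_insert_of_mem (hm i))) (not_le.mpr (hy i hik))

lemma sc_bwd (h : I → Y → ℕ) (hinj : ∀ i, Function.Injective (h i)) (s : Finset Y)
    (hds : ScDom h s) (m : I → Y) (hm : ∀ i, m i ∈ s)
    (hmin : ∀ i, ∀ x ∈ s, h i (m i) ≤ h i x) (k l : I) (hkl : k ≠ l) (hmkl : m k = m l)
    (x : Y) (hx : ScMax h m k x) : x ∉ s ∧ ScDom h (insert x s) := by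
  refine ⟨?_, ?_⟩
  · intro hxs
    obtain ⟨i, hi⟩ := hds x
    have hxi : x = m i := hinj i (le_antisymm (hi _ (hm i)) (hmin _ _ hxs))
    by_cases hik : i = k
    · subst hik
      have := hx.1 l hkl.symm
      rw [hxi, hmkl] at this
      exact lt_irrefl _ this
    · have := hx.1 i hik
      rw [hxi] at this
      exact lt_irrefl _ this
  · intro y
    by_cases hy : ∀ i, i ≠ k → h i (m i) < h i y
    · refine ⟨k, ?_⟩
      obtain ⟨i, hi⟩ := hds y
      have hik : i = k := by
        by_contra hik
        exact absurd (hi _ (hm i)) (not_le.mpr (hy i hik))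
      subst hik
      intro z hz
      rcases Finset.mem_insert.mp hz with rfl | hz
      · exact hx.2 y hy
      · exact hi z hz
    · push Not at hy
      obtain ⟨i, hik, hi⟩ := hy
      refine ⟨i, fun z hz => ?_⟩
      rcases Finset.mem_insert.mp hz with rfl | hz
      · exact hi.trans (hx.1 i hik).le
      · exact hi.trans (hmin i z hz)

lemma sc_iff (h : I → Y → ℕ) (hinj : ∀ i, Function.Injective (h i)) (s : Finset Y)
    (hd : ScDom h s) (m : I → Y) (i1 i2 : I) (hne : i1 ≠ i2)
    (heq : m i1 = m i2) (hm : ∀ i, m i ∈ s) (hmin : ∀ i, ∀ x ∈ s, h i (m i) ≤ h i x)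
    (h1 : ∀ i j, i ≠ i1 → j ≠ i1 → m i = m j → i = j)
    (h2 : ∀ i j, i ≠ i2 → j ≠ i2 → m i = m j → i = j) (x : Y) :
    (x ∉ s ∧ ScDom h (insert x s)) ↔ (ScMax h m i1 x ∨ ScMax h m i2 x) := by
  constructor
  · rintro ⟨hx, hdx⟩
    obtain ⟨k, hk⟩ := hdx x
    have hkx : ∀ y ∈ s, h k x ≤ h k y := fun y hy => hk y (Finset.mem_insert_of_mem hy)
    by_cases hk1 : k = i1
    · subst hk1; exact Or.inl (sc_fwd h hinj s m hm hmin k h1 x hx hdx hkx)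
    by_cases hk2 : k = i2
    · subst hk2; exact Or.inr (sc_fwd h hinj s m hm hmin k h2 x hx hdx hkx)
    exfalso
    obtain ⟨k', hk'⟩ := hdx (m k)
    have e1 : m k = m k' := hinj k' (le_antisymm
      (hk' _ (Finset.mem_insert_of_mem (hm k'))) (hmin _ _ (hm k)))
    have e2 : k = k' := by
      by_cases hk'1 : k' = i1
      · exact h2 k k' hk2 (by rw [hk'1]; exact hne) e1
      · exact h1 k k' hk1 hk'1 e1
    subst e2
    have : x = m k := hinj k (le_antisymm (hkx _ (hm k)) (hk' _ (Finset.mem_insert_self _ _)))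
    exact hx (this ▸ hm k)
  · rintro (hx | hx)
    · exact sc_bwd h hinj s hd m hm hmin i1 i2 hne heq x hx
    · exact sc_bwd h hinj s hd m hm hmin i2 i1 hne.symm heq.symm x hx

lemma sc_max_unique (h : I → Y → ℕ) (hinj : ∀ i, Function.Injective (h i))
    (m : I → Y) (k : I) (x y : Y) (hx : ScMax h m k x) (hy : ScMax h m k y) : x = y :=
  hinj k (le_antisymm (hy.2 x hx.1) (hx.2 y hy.1))

lemma sc_max_exists (h : I → Y → ℕ)
    (m : I → Y) (k : I) (y : Y) (hy : ∀ i, i ≠ k → h i (m i) < h i y) :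
    ∃ x, ScMax h m k x := by
  classical
  obtain ⟨x, hx, hmx⟩ := Finset.exists_max_image
    (Finset.univ.filter fun y => ∀ i, i ≠ k → h i (m i) < h i y) (h k) ⟨y, by simpa using hy⟩
  refine ⟨x, by simpa using hx, fun z hz => hmx z (by simpa using hz)⟩

open Classical in
lemma sc_count_two (h : I → Y → ℕ) (hinj : ∀ i, Function.Injective (h i)) (s : Finset Y)
    (hs : s.Nonempty) (hd : ScDom h s) (hc : s.card + 1 = Fintype.card I)
    (hM : ∀ k : I, ∃ y, ∀ i, i ≠ k → ∃ z ∈ s, h i z < h i y) :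
    (Finset.univ.filter fun x => x ∉ s ∧ ScDom h (insert x s)).card = 2 := by
  obtain ⟨m, i1, i2, hne, heq, hm, hmin, h1, h2⟩ := sc_struct h hinj s hs hd hc
  have hM' : ∀ k, ∃ x, ScMax h m k x := by
    intro k
    obtain ⟨y, hy⟩ := hM k
    refine sc_max_exists h m k y fun i hi => ?_
    obtain ⟨z, hz, hzy⟩ := hy i hi
    exact (hmin i z hz).trans_lt hzy
  obtain ⟨x1, hx1⟩ := hM' i1
  obtain ⟨x2, hx2⟩ := hM' i2
  rw [Finset.card_eq_two]
  refine ⟨x1, x2, ?_, ?_⟩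
  · rintro rfl
    obtain ⟨i, hi⟩ := hd x1
    have hi' := hi _ (hm i)
    by_cases hi1 : i = i1
    · exact absurd (hx2.1 i (by rw [hi1]; exact hne)) (not_lt.mpr hi')
    · exact absurd (hx1.1 i hi1) (not_lt.mpr hi')
  · ext x
    simp only [Finset.mem_filter, Finset.mem_univ, true_and, Finset.mem_insert,
      Finset.mem_singleton]
    rw [sc_iff h hinj s hd m i1 i2 hne heq hm hmin h1 h2]
    constructor
    · rintro (hx | hx)
      · exact Or.inl (sc_max_unique h hinj m _ _ _ hx hx1)
      · exact Or.inr (sc_max_unique h hinj m _ _ _ hx hx2)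
    · rintro (rfl | rfl)
      · exact Or.inl hx1
      · exact Or.inr hx2

open Classical in
lemma sc_count_one (h : I → Y → ℕ) (hinj : ∀ i, Function.Injective (h i)) (s : Finset Y)
    (hs : s.Nonempty) (hd : ScDom h s) (hc : s.card + 1 = Fintype.card I) (i0 : I)
    (hM : ∃ y, ∀ i, i ≠ i0 → ∃ z ∈ s, h i z < h i y)
    (hinj0 : ∀ i j z, i ≠ i0 → j ≠ i0 → z ∈ s → (∀ x ∈ s, h i z ≤ h i x) →
      (∀ x ∈ s, h j z ≤ h j x) → i = j)
    (hE : ∀ k, k ≠ i0 → ∀ w ∈ s, (∀ x ∈ s, h k w ≤ h k x) → (∀ x ∈ s, h i0 w ≤ h i0 x) →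
      ∀ y, ∃ i, i ≠ k ∧ ∃ z ∈ s, h i y ≤ h i z ∧ ∀ x ∈ s, h i z ≤ h i x) :
    (Finset.univ.filter fun x => x ∉ s ∧ ScDom h (insert x s)).card = 1 := by
  obtain ⟨m, i1, i2, hne, heq, hm, hmin, h1, h2⟩ := sc_struct h hinj s hs hd hc
  have hno : ∀ k, k ≠ i0 → m k = m i0 → ∀ x, ¬ ScMax h m k x := by
    intro k hk hmk x hx
    obtain ⟨i, hik, z, hz, hyz, hzx⟩ := hE k hk (m k) (hm k) (hmin k)
      (by rw [hmk]; exact hmin i0) x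
    have := hx.1 i hik
    exact absurd (hyz.trans (hzx _ (hm i))) (not_le.mpr this)
  have hyes : ∃ x, ScMax h m i0 x := by
    obtain ⟨y, hy⟩ := hM
    refine sc_max_exists h m i0 y fun i hi => ?_
    obtain ⟨z, hz, hzy⟩ := hy i hi
    exact (hmin i z hz).trans_lt hzy
  obtain ⟨x0, hx0⟩ := hyes
  have hi0 : i1 = i0 ∨ i2 = i0 := by
    by_contra hcon
    push Not at hcon
    exact hne (hinj0 i1 i2 (m i1) hcon.1 hcon.2 (hm _) (hmin _) (by rw [heq]; exact hmin _))
  rw [Finset.card_eq_one]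
  refine ⟨x0, ?_⟩
  ext x
  simp only [Finset.mem_filter, Finset.mem_univ, true_and, Finset.mem_singleton]
  rw [sc_iff h hinj s hd m i1 i2 hne heq hm hmin h1 h2]
  constructor
  · intro hx
    have hx' : ScMax h m i0 x := by
      rcases hx with hx | hx
      · by_cases hh : i1 = i0
        · rwa [hh] at hx
        · exact absurd hx (hno _ hh (by rw [heq, hi0.resolve_left hh]) _)
      · by_cases hh : i2 = i0
        · rwa [hh] at hx
        · exact absurd hx (hno _ hh (by rw [← heq, hi0.resolve_right hh]) _)
    exact sc_max_unique h hinj m _ _ _ hx' hx0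
  · rintro rfl
    rcases hi0 with hh | hh
    · left; rwa [hh]
    · right; rwa [hh]

lemma sc_room_even (c : Y → I) (i0 : I) (t : Finset Y) (ht : t.card = Fintype.card I)
    (hnc : t.image c ≠ Finset.univ) :
    Even (t.filter fun x => (t.erase x).image c = Finset.univ.erase i0).card := by
  rcases Finset.eq_empty_or_nonempty
    (t.filter fun x => (t.erase x).image c = Finset.univ.erase i0) with he | ⟨x, hx⟩
  · rw [he]; simp
  obtain ⟨hxt, hxi⟩ := Finset.mem_filter.mp hx
  have hcx : c x ≠ i0 := by
    intro hcx
    apply hnc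
    rw [← Finset.insert_erase hxt, Finset.image_insert, hxi, hcx]
    simp
  have hinj : Set.InjOn c (t.erase x : Finset Y) := by
    apply Finset.injOn_of_card_image_eq
    rw [hxi, Finset.card_erase_of_mem hxt, Finset.card_erase_of_mem (Finset.mem_univ _), ht,
      Finset.card_univ]
  have hx' : c x ∈ (t.erase x).image c := by rw [hxi]; simpa using hcx
  obtain ⟨x', hx't, hcx'⟩ := Finset.mem_image.mp hx'
  obtain ⟨hx'x, hx't'⟩ := Finset.mem_erase.mp hx't
  have : (t.filter fun x => (t.erase x).image c = Finset.univ.erase i0) = {x, x'} := by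
    ext y
    simp only [Finset.mem_filter, Finset.mem_insert, Finset.mem_singleton]
    constructor
    · rintro ⟨hyt, hyi⟩
      by_contra hcon
      push Not at hcon
      have hyt' : y ∈ t.erase x := Finset.mem_erase.mpr ⟨hcon.1, hyt⟩
      have : c y ∈ (t.erase y).image c := by
        rw [hyi, ← hxi]; exact Finset.mem_image_of_mem _ hyt'
      obtain ⟨z, hz, hzy⟩ := Finset.mem_image.mp this
      obtain ⟨hzy', hzt⟩ := Finset.mem_erase.mp hz
      by_cases hzx : z = x
      · subst hzx
        exact hcon.2 (hinj hyt' hx't (by rw [← hzy, hcx']))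
      · exact hzy' (hinj (Finset.mem_erase.mpr ⟨hzx, hzt⟩) hyt' hzy)
    · rintro (rfl | rfl)
      · exact ⟨hxt, hxi⟩
      · refine ⟨hx't', ?_⟩
        rw [← hxi]
        ext k
        simp only [Finset.mem_image, Finset.mem_erase]
        constructor
        · rintro ⟨z, ⟨hz1, hz2⟩, rfl⟩
          by_cases hzx : z = x
          · exact ⟨y, ⟨hx'x, hx't'⟩, by rw [hcx', hzx]⟩
          · exact ⟨z, ⟨hzx, hz2⟩, rfl⟩
        · rintro ⟨z, ⟨hz1, hz2⟩, rfl⟩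
          by_cases hzx : z = y
          · exact ⟨x, ⟨hx'x.symm, hxt⟩, by rw [← hcx', hzx]⟩
          · exact ⟨z, ⟨hzx, hz2⟩, rfl⟩
  rw [this, Finset.card_pair hx'x.symm]
  exact even_two

open Classical in
/-- Abstract parity argument. -/
lemma sc_parity (h : I → Y → ℕ) (c : Y → I) (i0 : I) (s0 : Finset Y)
    (hs0 : s0.card + 1 = Fintype.card I) (hd0 : ScDom h s0)
    (hc0 : s0.image c = Finset.univ.erase i0)
    (h0 : (Finset.univ.filter fun x => x ∉ s0 ∧ ScDom h (insert x s0)).card = 1)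
    (h2 : ∀ s : Finset Y, s ≠ s0 → s.card + 1 = Fintype.card I → ScDom h s →
      s.image c = Finset.univ.erase i0 →
      (Finset.univ.filter fun x => x ∉ s ∧ ScDom h (insert x s)).card = 2) :
    ∃ t : Finset Y, t.card = Fintype.card I ∧ ScDom h t ∧ t.image c = Finset.univ := by
  by_contra hcon
  push Not at hcon
  set Doors : Finset (Finset Y) := Finset.univ.filter fun s =>
    s.card + 1 = Fintype.card I ∧ ScDom h s ∧ s.image c = Finset.univ.erase i0 with hDoors
  set Rooms : Finset (Finset Y) := Finset.univ.filter fun t =>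
    t.card = Fintype.card I ∧ ScDom h t with hRooms
  have hsum : ∑ s ∈ Doors, (Finset.univ.filter fun x => x ∉ s ∧ ScDom h (insert x s)).card
      = ∑ t ∈ Rooms, (t.filter fun x => (t.erase x).image c = Finset.univ.erase i0).card := by
    rw [← Finset.card_sigma, ← Finset.card_sigma]
    refine Finset.card_bij' (fun p _ => ⟨insert p.2 p.1, p.2⟩) (fun p _ => ⟨p.1.erase p.2, p.2⟩)
      ?_ ?_ ?_ ?_
    · rintro ⟨s, x⟩ hp
      simp only [hDoors, hRooms, Finset.mem_sigma, Finset.mem_filter, Finset.mem_univ,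
        true_and] at hp ⊢
      obtain ⟨⟨a1, a2, a3⟩, a4, a5⟩ := hp
      refine ⟨⟨?_, a5⟩, Finset.mem_insert_self _ _, ?_⟩
      · rw [Finset.card_insert_of_notMem a4, a1]
      · rw [Finset.erase_insert a4, a3]
    · rintro ⟨t, x⟩ hp
      simp only [hDoors, hRooms, Finset.mem_sigma, Finset.mem_filter, Finset.mem_univ,
        true_and] at hp ⊢
      obtain ⟨⟨a1, a2⟩, a4, a5⟩ := hp
      refine ⟨⟨?_, ?_, a5⟩, Finset.notMem_erase _ _, ?_⟩
      · rw [Finset.card_erase_add_one a4, a1]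
      · intro y
        obtain ⟨i, hi⟩ := a2 y
        exact ⟨i, fun z hz => hi z (Finset.mem_of_mem_erase hz)⟩
      · rw [Finset.insert_erase a4]; exact a2
    · rintro ⟨s, x⟩ hp
      simp only [Finset.mem_sigma, Finset.mem_filter, Finset.mem_univ, true_and] at hp
      simp [Finset.erase_insert hp.2.1]
    · rintro ⟨t, x⟩ hp
      simp only [Finset.mem_sigma, Finset.mem_filter] at hp
      simp [Finset.insert_erase hp.2.1]
  have hE : Even (∑ t ∈ Rooms,
      (t.filter fun x => (t.erase x).image c = Finset.univ.erase i0).card) := by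
    apply Finset.even_sum
    intro t ht
    simp only [hRooms, Finset.mem_filter, Finset.mem_univ, true_and] at ht
    exact sc_room_even c i0 t ht.1 (hcon t ht.1 ht.2)
  have hs0D : s0 ∈ Doors := by simp [hDoors, hs0, hd0, hc0]
  rw [← hsum, ← Finset.add_sum_erase _ _ hs0D, h0] at hE
  have hE2 : Even (∑ s ∈ Doors.erase s0,
      (Finset.univ.filter fun x => x ∉ s ∧ ScDom h (insert x s)).card) := by
    apply Finset.even_sum
    intro s hs
    simp only [hDoors, Finset.mem_erase, Finset.mem_filter, Finset.mem_univ, true_and] at hs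
    rw [h2 s hs.1 hs.2.1 hs.2.2.1 hs.2.2.2]
    exact even_two
  rw [Nat.even_add] at hE
  exact absurd (hE.mpr hE2) (by decide)

end ScarfAbstract

section ScarfSlack

set_option linter.unusedSectionVars false

variable {I X : Type} [Fintype I] [DecidableEq I] [Fintype X] [DecidableEq X]

/-- Orders on the set with slack elements added. -/
def scH (e : I → ℕ) (B : ℕ) (g : I → X → ℕ) (i : I) : I ⊕ X → ℕ
  | Sum.inl k => if k = i then 0 else B + 1 + e k
  | Sum.inr x => g i x + 1

lemma scH_inj (e : I → ℕ) (he : Function.Injective e) (B : ℕ) (g : I → X → ℕ)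
    (hg : ∀ i, Function.Injective (g i)) (hB : ∀ i x, g i x < B) (i : I) :
    Function.Injective (scH e B g i) := by
  rintro (a | a) (b | b) hab
  · simp only [scH] at hab
    split_ifs at hab with h1 h2 h2
    · rw [h1, h2]
    · omega
    · omega
    · exact congrArg _ (he (by omega))
  · simp only [scH] at hab
    have := hB i b
    split_ifs at hab <;> omega
  · simp only [scH] at hab
    have := hB i a
    split_ifs at hab <;> omega
  · simp only [scH] at hab
    exact congrArg _ (hg i (by omega))

/-- Scarf's lemma. -/
theorem scarf (hI : 2 ≤ Fintype.card I) [Nonempty X] (g : I → X → ℕ)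
    (hg : ∀ i, Function.Injective (g i)) (c : X → I) :
    ∃ (C : Finset I) (s : Finset X), s.Nonempty ∧
      (∀ y, ∃ i ∈ C, ∀ x ∈ s, g i y ≤ g i x) ∧ ∀ i ∈ C, ∃ x ∈ s, c x = i := by
  classical
  obtain ⟨B, hB⟩ : ∃ B, ∀ i x, g i x < B := by
    refine ⟨(∑ i, ∑ x, g i x) + 1, fun i x => Nat.lt_succ_of_le ?_⟩
    calc g i x ≤ ∑ x, g i x := Finset.single_le_sum (f := fun x => g i x)
          (fun _ _ => Nat.zero_le _) (Finset.mem_univ x)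
      _ ≤ _ := Finset.single_le_sum (f := fun i => ∑ x, g i x)
          (fun _ _ => Nat.zero_le _) (Finset.mem_univ i)
  obtain ⟨e, he⟩ : ∃ e : I → ℕ, Function.Injective e :=
    ⟨fun i => (Fintype.equivFin I i : ℕ), fun a b hab =>
      (Fintype.equivFin I).injective (Fin.ext hab)⟩
  have hne : Nonempty I := Fintype.card_pos_iff.mp (by omega)
  obtain ⟨i0⟩ := hne
  obtain ⟨x0⟩ := (inferInstance : Nonempty X)
  set h := scH e B g with hh
  have hinj : ∀ i, Function.Injective (h i) := scH_inj e he B g hg hB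
  have hll : ∀ i, h i (Sum.inl i) = 0 := by intro i; simp [hh, scH]
  have hl : ∀ i k, k ≠ i → h i (Sum.inl k) = B + 1 + e k := by
    intro i k hk; simp [hh, scH, hk]
  have hr : ∀ i x, h i (Sum.inr x) = g i x + 1 := by intro i x; simp [hh, scH]
  set c' : I ⊕ X → I := Sum.elim id c with hc'
  set s0 : Finset (I ⊕ X) := (Finset.univ.erase i0).image Sum.inl with hs0
  have hms0 : ∀ z, z ∈ s0 ↔ ∃ k, k ≠ i0 ∧ z = Sum.inl k := by
    intro z; simp [hs0, eq_comm]
  have hcard0 : s0.card + 1 = Fintype.card I := by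
    rw [hs0, Finset.card_image_of_injective _ Sum.inl_injective,
      Finset.card_erase_of_mem (Finset.mem_univ _), Finset.card_univ]; omega
  have hne0 : s0.Nonempty := by
    rw [← Finset.card_pos]; omega
  have hmin0 : ∀ k w, w ∈ s0 → k ≠ i0 → (∀ x ∈ s0, h k w ≤ h k x) → w = Sum.inl k := by
    intro k w hw hk hm
    have := hm (Sum.inl k) ((hms0 _).mpr ⟨k, hk, rfl⟩)
    rw [hll] at this
    exact hinj k (by rw [hll]; omega)
  have hd0 : ScDom h s0 := by
    rintro (k | x)
    · exact ⟨k, fun z _ => by rw [hll]; exact Nat.zero_le _⟩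
    · refine ⟨i0, fun z hz => ?_⟩
      obtain ⟨k, hk, rfl⟩ := (hms0 z).mp hz
      rw [hr, hl _ _ hk]
      have := hB i0 x
      omega
  obtain ⟨t, htc, htd, hti⟩ := sc_parity h c' i0 s0 hcard0 hd0
    (by rw [hs0, Finset.image_image]; simp [hc', Function.comp_def])
    (by
      refine sc_count_one h hinj s0 hne0 hd0 hcard0 i0 ?_ ?_ ?_
      · refine ⟨Sum.inr x0, fun i hi => ⟨Sum.inl i, (hms0 _).mpr ⟨i, hi, rfl⟩, ?_⟩⟩
        rw [hll, hr]; omega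
      · intro i j z hi hj hz h1 h2
        have e1 := hmin0 i z hz hi h1
        have e2 := hmin0 j z hz hj h2
        exact Sum.inl_injective (e1.symm.trans e2)
      · intro k hk w hw h1 h2 y
        have e1 := hmin0 k w hw hk h1
        rcases y with j | x
        · by_cases hjk : j = k
          · exact ⟨i0, hk.symm, w, hw, by rw [e1, hjk], h2⟩
          · by_cases hj0 : j = i0
            · exact ⟨i0, hk.symm, w, hw, by rw [hj0, hll]; exact Nat.zero_le _, h2⟩
            · exact ⟨j, hjk, Sum.inl j, (hms0 _).mpr ⟨j, hj0, rfl⟩, le_rfl,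
                fun x _ => by rw [hll]; exact Nat.zero_le _⟩
        · refine ⟨i0, hk.symm, w, hw, ?_, h2⟩
          rw [e1, hr, hl _ _ hk]
          have := hB i0 x
          omega)
    (by
      intro s hs hsc hsd hsi
      have hsne : s.Nonempty := by rw [← Finset.card_pos]; omega
      -- s contains an element of X
      have hX : ∃ x, Sum.inr x ∈ s := by
        by_contra hcon
        push Not at hcon
        apply hs
        apply Finset.eq_of_subset_of_card_le
        · rintro (k | x) hz
          · rw [hms0]
            refine ⟨k, ?_, rfl⟩
            have : c' (Sum.inl k) ∈ s.image c' := Finset.mem_image_of_mem _ hz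
            rw [hsi] at this
            simpa [hc'] using this
          · exact absurd hz (hcon x)
        · omega
      obtain ⟨x, hx⟩ := hX
      refine sc_count_two h hinj s hsne hsd hsc fun k => ⟨Sum.inl k, fun i hi => ?_⟩
      refine ⟨Sum.inr x, hx, ?_⟩
      rw [hr, hl _ _ hi.symm]
      have := hB i x
      omega)
  refine ⟨Finset.univ.filter fun i => Sum.inl i ∉ t, Finset.univ.filter fun x => Sum.inr x ∈ t,
    ?_, ?_, ?_⟩
  rotate_left
  · intro y
    obtain ⟨i, hi⟩ := htd (Sum.inr y)
    refine ⟨i, ?_, ?_⟩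
    · simp only [Finset.mem_filter, Finset.mem_univ, true_and]
      intro hit
      have := hi _ hit
      rw [hll, hr] at this
      omega
    · intro x hx
      simp only [Finset.mem_filter, Finset.mem_univ, true_and] at hx
      have := hi _ hx
      rw [hr, hr] at this
      omega
  · intro i hi
    simp only [Finset.mem_filter, Finset.mem_univ, true_and] at hi ⊢
    have : i ∈ t.image c' := by rw [hti]; exact Finset.mem_univ _
    obtain ⟨z, hz, hzi⟩ := Finset.mem_image.mp this
    rcases z with k | x
    · simp only [hc', Sum.elim_inl, id] at hzi
      subst hzi
      exact absurd hz hi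
    · exact ⟨x, hz, hzi⟩
  · obtain ⟨i, hi⟩ := htd (Sum.inr x0)
    have : i ∈ t.image c' := by rw [hti]; exact Finset.mem_univ _
    obtain ⟨z, hz, hzi⟩ := Finset.mem_image.mp this
    rcases z with k | x
    · simp only [hc', Sum.elim_inl, id] at hzi
      subst hzi
      have := hi _ hz
      rw [hll, hr] at this
      omega
    · exact ⟨x, by simpa using hz⟩

end ScarfSlack

section BrouwerSimplex

set_option linter.unusedSectionVars false

variable {I : Type} [Fintype I] [DecidableEq I]

/-- Grid points of the simplex. -/
abbrev ScGrid (I : Type) [Fintype I] (N : ℕ) : Type :=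
  {x : I → Fin (N + 1) // ∑ i, (x i : ℕ) = N}

lemma scgrid_mk (N : ℕ) (y : I → ℕ) (hy : ∑ i, y i = N) :
    ∃ x : ScGrid I N, ∀ i, (x.1 i : ℕ) = y i := by
  have hle : ∀ i, y i < N + 1 := fun i => Nat.lt_succ_of_le (by
    rw [← hy]
    exact Finset.single_le_sum (f := y) (fun _ _ => Nat.zero_le _) (Finset.mem_univ i))
  exact ⟨⟨fun i => ⟨y i, hle i⟩, by simpa using hy⟩, fun i => rfl⟩

lemma scgrid_mk_ge [Nonempty I] (N : ℕ) (y : I → ℕ) (hy : ∑ i, y i ≤ N) :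
    ∃ x : ScGrid I N, ∀ i, y i ≤ (x.1 i : ℕ) := by
  obtain ⟨k⟩ := (inferInstance : Nonempty I)
  obtain ⟨x, hx⟩ := scgrid_mk N (fun i => y i + if i = k then N - ∑ i, y i else 0) (by
    rw [Finset.sum_add_distrib, Finset.sum_ite_eq']
    simp only [Finset.mem_univ, if_true]
    omega)
  exact ⟨x, fun i => by rw [hx]; omega⟩

lemma scgrid_cell (hI : 2 ≤ Fintype.card I) (N : ℕ) (c : ScGrid I N → I) :
    ∃ (C : Finset I) (s : Finset (ScGrid I N)), s.Nonempty ∧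
      (∀ x ∈ s, ∀ x' ∈ s, ∀ i, (x.1 i : ℕ) ≤ x'.1 i + Fintype.card I) ∧
      (∀ i ∉ C, ∀ x ∈ s, (x.1 i : ℕ) ≤ Fintype.card I) ∧
      ∀ i ∈ C, ∃ x ∈ s, c x = i := by
  classical
  have hneI : Nonempty I := Fintype.card_pos_iff.mp (by omega)
  have hne : Nonempty (ScGrid I N) := by
    obtain ⟨x, -⟩ := scgrid_mk_ge (I := I) N (fun _ => 0) (by simp)
    exact ⟨x⟩
  set M := Fintype.card (ScGrid I N) with hM
  set E := Fintype.equivFin (ScGrid I N)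
  obtain ⟨C, s, hs, hdom, hcol⟩ := scarf hI
    (fun (i : I) (x : ScGrid I N) => (x.1 i : ℕ) * M + (E x : ℕ)) (by
      intro i x y hxy
      apply E.injective
      apply Fin.ext
      have h1 := congrArg (· % M) hxy
      simp only [Nat.mul_add_mod_self_right] at h1
      rwa [Nat.mod_eq_of_lt (E x).2, Nat.mod_eq_of_lt (E y).2] at h1) c
  have hdom' : ∀ y : ScGrid I N, ∃ i ∈ C, ∀ x ∈ s, (y.1 i : ℕ) ≤ x.1 i := by
    intro y
    obtain ⟨i, hi, h⟩ := hdom y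
    refine ⟨i, hi, fun x hx => ?_⟩
    have h1 := h x hx
    by_contra hcon
    push Not at hcon
    have h2 : ((x.1 i : ℕ) + 1) * M ≤ (y.1 i : ℕ) * M := Nat.mul_le_mul_right _ hcon
    have h3 : (E x : ℕ) < M := (E x).2
    rw [add_mul] at h2
    omega
  choose z hz hzmin using fun i : I => Finset.exists_min_image s (fun x => (x.1 i : ℕ)) hs
  set y : I → ℕ := fun i => if i ∈ C then (z i).1 i + 1 else 0 with hy
  have hsum : N < ∑ i, y i := by
    by_contra hcon
    push Not at hcon
    obtain ⟨x, hx⟩ := scgrid_mk_ge N y hcon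
    obtain ⟨i, hi, hle⟩ := hdom' x
    have h1 := hle _ (hz i)
    have h2 := hx i
    simp only [hy, hi, if_true] at h2
    omega
  -- each `x ∈ s` satisfies `x i < m i + card`
  have hub : ∀ x ∈ s, ∀ i, (x.1 i : ℕ) + 1 ≤ y i + Fintype.card I := by
    intro x hx i
    by_contra hcon
    push Not at hcon
    have h1 : ∑ j, (y j) ≤ ∑ j, ((x.1 j : ℕ) + 1) - (Fintype.card I) := by
      rw [← Finset.add_sum_erase _ _ (Finset.mem_univ i),
        ← Finset.add_sum_erase _ (fun j => (x.1 j : ℕ) + 1) (Finset.mem_univ i)]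
      have : ∑ j ∈ Finset.univ.erase i, y j ≤ ∑ j ∈ Finset.univ.erase i, ((x.1 j : ℕ) + 1) := by
        apply Finset.sum_le_sum
        intro j _
        simp only [hy]
        split_ifs
        · have := hzmin j x hx
          omega
        · omega
      omega
    rw [Finset.sum_add_distrib, x.2] at h1
    simp at h1
    omega
  refine ⟨C, s, hs, ?_, ?_, hcol⟩
  · intro x hx x' hx' i
    have h1 := hub x hx i
    simp only [hy] at h1
    split_ifs at h1
    · have := hzmin i x' hx'
      omega
    · omega
  · intro i hi x hx
    have h1 := hub x hx i
    simp only [hy, hi, if_false] at h1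
    omega

lemma sc_approx (hI : 2 ≤ Fintype.card I) (f : (I → ℝ) → (I → ℝ))
    (hm : Set.MapsTo f (stdSimplex ℝ I) (stdSimplex ℝ I)) (ε : ℝ) (hε : 0 < ε) :
    ∃ x ∈ stdSimplex ℝ I, ∀ i, ∃ w ∈ stdSimplex ℝ I, dist w x ≤ ε ∧ w i - ε ≤ f w i := by
  have hneI : Nonempty I := Fintype.card_pos_iff.mp (by omega)
  obtain ⟨N, hN⟩ := exists_nat_gt ((Fintype.card I : ℝ) / ε)
  have hN0 : (0 : ℝ) < N := lt_of_le_of_lt (by positivity) hN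
  have hNε : (Fintype.card I : ℝ) ≤ ε * N := by
    rw [div_lt_iff₀ hε] at hN; linarith
  set v : ScGrid I N → (I → ℝ) := fun x i => ((x.1 i : ℕ) : ℝ) / N with hv
  have hvS : ∀ x, v x ∈ stdSimplex ℝ I := by
    intro x
    refine ⟨fun i => by simp only [hv]; positivity, ?_⟩
    simp only [hv]
    rw [← Finset.sum_div, ← Nat.cast_sum, x.2]
    exact div_self hN0.ne'
  have hcol : ∀ x : ScGrid I N, ∃ i, v x i ≤ f (v x) i := by
    intro x
    obtain ⟨i, -, hi⟩ := Finset.exists_le_of_sum_le (s := Finset.univ) (f := v x)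
      (g := f (v x)) Finset.univ_nonempty (by rw [(hvS x).2, (hm (hvS x)).2])
    exact ⟨i, hi⟩
  choose c hc using hcol
  obtain ⟨C, s, ⟨x, hx⟩, h1, h2, h3⟩ := scgrid_cell hI N c
  refine ⟨v x, hvS x, fun i => ?_⟩
  by_cases hi : i ∈ C
  · obtain ⟨w, hw, hwi⟩ := h3 i hi
    refine ⟨v w, hvS w, ?_, ?_⟩
    · rw [dist_pi_le_iff hε.le]
      intro j
      have a1 : ((w.1 j : ℕ) : ℝ) ≤ (x.1 j : ℕ) + Fintype.card I := by
        exact_mod_cast h1 w hw x hx j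
      have a2 : ((x.1 j : ℕ) : ℝ) ≤ (w.1 j : ℕ) + Fintype.card I := by
        exact_mod_cast h1 x hx w hw j
      simp only [hv, Real.dist_eq]
      rw [← sub_div, abs_div, abs_of_pos hN0, div_le_iff₀ hN0, abs_le]
      constructor <;> linarith
    · have := hc w
      rw [hwi] at this
      linarith
  · refine ⟨v x, hvS x, by simpa using hε.le, ?_⟩
    have a1 : ((x.1 i : ℕ) : ℝ) ≤ Fintype.card I := by exact_mod_cast h2 i hi x hx
    have a2 : v x i ≤ ε := by
      simp only [hv]
      rw [div_le_iff₀ hN0]; linarith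
    have := (hm (hvS x)).1 i
    linarith

/-- Brouwer's theorem on the standard simplex. -/
theorem sc_brouwer (hI : 2 ≤ Fintype.card I) (f : (I → ℝ) → (I → ℝ))
    (hf : ContinuousOn f (stdSimplex ℝ I))
    (hm : Set.MapsTo f (stdSimplex ℝ I) (stdSimplex ℝ I)) :
    ∃ x ∈ stdSimplex ℝ I, f x = x := by
  have hneI : Nonempty I := Fintype.card_pos_iff.mp (by omega)
  have hK : IsCompact (stdSimplex ℝ I) := isCompact_stdSimplex ℝ I
  have hu := hK.uniformContinuousOn_of_continuous hf
  rw [Metric.uniformContinuousOn_iff] at hu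
  have happ : ∀ ε > 0, ∃ x ∈ stdSimplex ℝ I, ∀ i, x i - f x i ≤ ε := by
    intro ε hε
    obtain ⟨δ, hδ, hδ'⟩ := hu (ε / 3) (by positivity)
    obtain ⟨x, hx, h⟩ := sc_approx hI f hm (min (δ / 2) (ε / 3)) (by positivity)
    refine ⟨x, hx, fun i => ?_⟩
    obtain ⟨w, hw, hwx, hwi⟩ := h i
    have b1 := min_le_left (δ / 2) (ε / 3)
    have b2 := min_le_right (δ / 2) (ε / 3)
    have a1 := (dist_le_pi_dist _ _ i).trans_lt (hδ' w hw x hx (by linarith))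
    have a2 := (dist_le_pi_dist _ _ i).trans hwx
    rw [Real.dist_eq, abs_lt] at a1
    rw [Real.dist_eq, abs_le] at a2
    linarith [a1.2, a2.1]
  have hne : (stdSimplex ℝ I).Nonempty := by
    obtain ⟨x, hx, -⟩ := happ 1 one_pos
    exact ⟨x, hx⟩
  obtain ⟨x, hx, hmin⟩ := hK.exists_isMinOn hne
    (f := fun x => ∑ i, max (x i - f x i) 0) (by
      refine continuousOn_finsetSum _ fun i _ => ?_
      refine ContinuousOn.sup ?_ continuousOn_const
      exact (continuous_apply i).continuousOn.sub
        ((continuous_apply i).comp_continuousOn hf))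
  have hle : ∑ i, max (x i - f x i) 0 ≤ 0 := by
    apply le_of_forall_pos_le_add
    intro ε hε
    have hn : (0 : ℝ) < Fintype.card I := by exact_mod_cast Fintype.card_pos
    obtain ⟨y, hy, hyi⟩ := happ (ε / Fintype.card I) (by positivity)
    calc ∑ i, max (x i - f x i) 0 ≤ ∑ i, max (y i - f y i) 0 := hmin hy
      _ ≤ ∑ i : I, ε / Fintype.card I := Finset.sum_le_sum fun i _ =>
          max_le (hyi i) (by positivity)
      _ = 0 + ε := by
          rw [Finset.sum_const, Finset.card_univ, nsmul_eq_mul]; field_simp; simp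
  have hle' : ∀ i, x i ≤ f x i := by
    intro i
    have h1 : max (x i - f x i) 0 ≤ ∑ i, max (x i - f x i) 0 :=
      Finset.single_le_sum (f := fun i => max (x i - f x i) 0)
        (fun _ _ => le_max_right _ _) (Finset.mem_univ i)
    have h2 := le_max_left (x i - f x i) 0
    linarith
  refine ⟨x, hx, ?_⟩
  have heq := (Finset.sum_eq_sum_iff_of_le (s := Finset.univ) (f := x) (g := f x)
    fun i _ => hle' i).mp (by rw [hx.2, (hm hx).2])
  funext i
  exact (heq i (Finset.mem_univ i)).symm

end BrouwerSimplex

section NashPart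

/-- The set of joint strategies. -/
def ScProf (n : ℕ) (A : Fin n → ℕ) : Set (∀ j, Fin (A j) → ℝ) :=
  {π | ∀ j, π j ∈ stdSimplex ℝ (Fin (A j))}

/-- Retraction from the big simplex onto the product of simplices. -/
noncomputable def scRet (n : ℕ) (A : Fin n → ℕ) (z : (Σ i : Fin n, Fin (A i)) → ℝ) :
    ∀ j, Fin (A j) → ℝ := fun i a =>
  (z ⟨i, a⟩ + max (1 / (n : ℝ) - ∑ b, z ⟨i, b⟩) 0 / A i) / max (1 / (n : ℝ)) (∑ b, z ⟨i, b⟩)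

lemma scRet_mem (n : ℕ) (hn : 2 ≤ n) (A : Fin n → ℕ) (hA : ∀ i, 1 ≤ A i)
    (z : (Σ i : Fin n, Fin (A i)) → ℝ) (hz : z ∈ stdSimplex ℝ (Σ i : Fin n, Fin (A i))) :
    scRet n A z ∈ ScProf n A := by
  have hn0 : (0 : ℝ) < 1 / n := by
    have : (0 : ℝ) < n := by exact_mod_cast (by omega : 0 < n)
    positivity
  intro i
  have hAi : (0 : ℝ) < A i := by exact_mod_cast hA i
  have hpos : 0 < max (1 / (n : ℝ)) (∑ b, z ⟨i, b⟩) := lt_of_lt_of_le hn0 (le_max_left _ _)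
  refine ⟨fun a => ?_, ?_⟩
  · refine div_nonneg (add_nonneg (hz.1 _) (div_nonneg (le_max_right _ _) hAi.le)) hpos.le
  · simp only [scRet]
    rw [← Finset.sum_div, div_eq_one_iff_eq hpos.ne', Finset.sum_add_distrib, Finset.sum_const,
      Finset.card_univ, Fintype.card_fin, nsmul_eq_mul, mul_div_cancel₀ _ hAi.ne']
    rcases le_total (1 / (n : ℝ)) (∑ b, z ⟨i, b⟩) with h | h
    · rw [max_eq_right h, max_eq_right (by linarith)]; ring
    · rw [max_eq_left h, max_eq_left (by linarith)]; ring

lemma scRet_cont (n : ℕ) (hn : 2 ≤ n) (A : Fin n → ℕ) : Continuous (scRet n A) := by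
  have hn0 : (0 : ℝ) < 1 / n := by
    have : (0 : ℝ) < n := by exact_mod_cast (by omega : 0 < n)
    positivity
  refine continuous_pi fun i => continuous_pi fun a => ?_
  refine Continuous.div (by fun_prop) (by fun_prop) fun z => ?_
  exact (lt_of_lt_of_le hn0 (le_max_left _ _)).ne'

lemma sc_brouwer_prod (n : ℕ) (hn : 2 ≤ n) (A : Fin n → ℕ) (hA : ∀ i, 1 ≤ A i)
    (F : (∀ j, Fin (A j) → ℝ) → (∀ j, Fin (A j) → ℝ))
    (hF : ContinuousOn F (ScProf n A)) (hm : Set.MapsTo F (ScProf n A) (ScProf n A)) :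
    ∃ π ∈ ScProf n A, F π = π := by
  have hn0 : (0 : ℝ) < n := by exact_mod_cast (by omega : 0 < n)
  have hcard : 2 ≤ Fintype.card (Σ i : Fin n, Fin (A i)) := by
    rw [Fintype.card_sigma]
    calc 2 ≤ ∑ i : Fin n, 1 := by simpa using hn
      _ ≤ _ := Finset.sum_le_sum fun i _ => by simpa using hA i
  have hret : Set.MapsTo (scRet n A) (stdSimplex ℝ (Σ i : Fin n, Fin (A i))) (ScProf n A) :=
    fun z hz => scRet_mem n hn A hA z hz
  obtain ⟨z, hz, hfix⟩ := sc_brouwer hcard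
    (fun z p => F (scRet n A z) p.1 p.2 / n) (by
      have h1 := hF.comp (scRet_cont n hn A).continuousOn hret
      refine continuousOn_pi.mpr fun p => ?_
      refine ContinuousOn.div_const ?_ _
      exact (continuous_apply p.2).comp_continuousOn
        ((continuous_apply p.1).comp_continuousOn h1)) (by
      intro z hz
      have h1 := hm (hret hz)
      refine ⟨fun p => div_nonneg ((h1 p.1).1 p.2) hn0.le, ?_⟩
      rw [Fintype.sum_sigma]
      simp only
      simp_rw [← Finset.sum_div]
      rw [Finset.sum_congr rfl fun i _ => (h1 i).2]
      simp [hn0.ne'])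
  refine ⟨scRet n A z, hret hz, ?_⟩
  have h1 := hm (hret hz)
  funext i a
  have hz' : ∀ b, z ⟨i, b⟩ = F (scRet n A z) i b / n := fun b => (congrFun hfix ⟨i, b⟩).symm
  have ht : ∑ b, z ⟨i, b⟩ = 1 / n := by
    simp_rw [hz']
    rw [← Finset.sum_div, (h1 i).2]
  have : scRet n A z i a = z ⟨i, a⟩ * n := by
    simp only [scRet, ht]
    simp
  rw [this, hz' a]
  field_simp

lemma sc_nash (n : ℕ) (hn : 2 ≤ n) (A : Fin n → ℕ) (hA : ∀ i, 1 ≤ A i)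
    (c : ∀ i, Fin (A i) → (∀ j, Fin (A j) → ℝ) → ℝ)
    (hc : ∀ i a, ContinuousOn (c i a) (ScProf n A)) :
    ∃ π ∈ ScProf n A, ∀ i, ∀ x ∈ stdSimplex ℝ (Fin (A i)),
      ∑ a, π i a * c i a π ≤ ∑ a, x a * c i a π := by
  set G : ∀ i, Fin (A i) → (∀ j, Fin (A j) → ℝ) → ℝ :=
    fun i a π => max (∑ b, π i b * c i b π - c i a π) 0 with hG
  have hG0 : ∀ i a π, 0 ≤ G i a π := fun i a π => le_max_right _ _
  have hGc : ∀ i a, ContinuousOn (G i a) (ScProf n A) := by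
    intro i a
    refine ContinuousOn.sup (ContinuousOn.sub ?_ (hc i a)) continuousOn_const
    refine continuousOn_finsetSum _ fun b _ => ContinuousOn.mul ?_ (hc i b)
    exact Continuous.continuousOn (by fun_prop)
  have hden : ∀ i π, 0 < 1 + ∑ b, G i b π := fun i π => by
    have := Finset.sum_nonneg fun b (_ : b ∈ Finset.univ) => hG0 i b π
    linarith
  obtain ⟨π, hπ, hfix⟩ := sc_brouwer_prod n hn A hA
    (fun π i a => (π i a + G i a π) / (1 + ∑ b, G i b π)) (by
      refine continuousOn_pi.mpr fun i => continuousOn_pi.mpr fun a => ?_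
      refine ContinuousOn.div (ContinuousOn.add ?_ (hGc i a)) ?_ fun π _ => (hden i π).ne'
      · exact Continuous.continuousOn (by fun_prop)
      · exact continuousOn_const.add (continuousOn_finsetSum _ fun b _ => hGc i b)) (by
      intro π hπ i
      refine ⟨fun a => div_nonneg (add_nonneg ((hπ i).1 a) (hG0 _ _ _)) (hden i π).le, ?_⟩
      simp only
      rw [← Finset.sum_div, Finset.sum_add_distrib, (hπ i).2, div_self (hden i π).ne'])
  refine ⟨π, hπ, fun i x hx => ?_⟩
  set v := ∑ b, π i b * c i b π with hv
  have hf : ∀ a, G i a π = π i a * ∑ b, G i b π := by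
    intro a
    have h1 : (π i a + G i a π) / (1 + ∑ b, G i b π) = π i a := congrFun (congrFun hfix i) a
    rw [div_eq_iff (hden i π).ne'] at h1
    linarith
  -- some action with positive weight has no gain
  have hex : ∃ a, 0 < π i a ∧ v ≤ c i a π := by
    by_contra hcon
    push Not at hcon
    have h1 : ∀ a, π i a * c i a π ≤ π i a * v := by
      intro a
      rcases ((hπ i).1 a).eq_or_lt with h | h
      · rw [← h]; simp
      · exact mul_le_mul_of_nonneg_left (hcon a h).le h.le
    obtain ⟨a, -, ha⟩ : ∃ a ∈ Finset.univ, 0 < π i a := by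
      apply Finset.exists_lt_of_sum_lt (f := fun _ => (0 : ℝ))
      rw [(hπ i).2]; simp
    have h2 : ∑ a, π i a * c i a π < ∑ a, π i a * v :=
      Finset.sum_lt_sum (fun a _ => h1 a)
        ⟨a, Finset.mem_univ a, mul_lt_mul_of_pos_left (hcon a ha) ha⟩
    rw [← Finset.sum_mul, (hπ i).2, one_mul] at h2
    exact lt_irrefl _ h2
  obtain ⟨a, ha, hav⟩ := hex
  have hGa : G i a π = 0 := max_eq_right (by linarith)
  have hS : ∑ b, G i b π = 0 := by
    have := hf a
    rw [hGa] at this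
    rcases mul_eq_zero.mp this.symm with h | h
    · exact absurd h ha.ne'
    · exact h
  have hle : ∀ b, v ≤ c i b π := by
    intro b
    have h1 := hf b
    rw [hS, mul_zero] at h1
    have h2 : v - c i b π ≤ G i b π := le_max_left _ _
    linarith
  calc v = ∑ b, x b * v := by rw [← Finset.sum_mul, hx.2, one_mul]
    _ ≤ _ := Finset.sum_le_sum fun b _ => mul_le_mul_of_nonneg_left (hle b) (hx.1 b)

lemma sc_oppCompact (n : ℕ) (A : Fin n → ℕ) (i : Fin n) : IsCompact (OppSimplex n A i) := by
  have : OppSimplex n A i = Set.univ.pi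
      (fun j : {j : Fin n // j ≠ i} => stdSimplex ℝ (Fin (A j.1))) := by
    ext p; simp [OppSimplex]
  rw [this]
  exact isCompact_univ_pi fun j => isCompact_stdSimplex ℝ _

lemma sc_costCont (n : ℕ) (A : Fin n → ℕ) (i : Fin n) (r : OppIdx n A i → ℝ)
    (D : OppProfile n A i → OppProfile n A i → ℝ)
    (hD : ContinuousOn (fun q : OppProfile n A i × OppProfile n A i => D q.1 q.2)
      (OppSimplex n A i ×ˢ OppSimplex n A i)) :
    ContinuousOn (fun π : ∀ j, Fin (A j) → ℝ =>
      sSup ((fun p => -(rowPair n A i r p) - D p (restr n A π i)) '' OppSimplex n A i))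
      (ScProf n A) := by
  rw [continuousOn_iff_continuous_domRestrict]
  have : CompactSpace (OppSimplex n A i) := isCompact_iff_compactSpace.mp (sc_oppCompact n A i)
  have h := IsCompact.continuous_sSup (K := (Set.univ : Set (OppSimplex n A i)))
    (f := fun (π : ScProf n A) (p : OppSimplex n A i) =>
      -(rowPair n A i r p.1) - D p.1 (restr n A π.1 i)) isCompact_univ (by
      refine Continuous.sub ?_ ?_
      · have hr : Continuous (rowPair n A i r) := by
          unfold rowPair
          refine continuous_finsetSum _ fun b _ => continuous_const.mul ?_
          exact (continuous_apply b.2).comp (continuous_apply b.1)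
        exact (hr.comp (continuous_subtype_val.comp continuous_snd)).neg
      · refine hD.comp_continuous (f := fun q : ScProf n A × OppSimplex n A i =>
          (q.2.1, restr n A q.1.1 i)) ?_ ?_
        · refine (continuous_subtype_val.comp continuous_snd).prodMk ?_
          refine continuous_pi fun j => ?_
          exact (continuous_apply j.1).comp (continuous_subtype_val.comp continuous_fst)
        · rintro ⟨π, p⟩
          exact ⟨p.2, fun j => π.2 j.1⟩)
  convert h using 2 with π
  simp only [Set.domRestrict_apply]
  congr 1
  ext y
  simp

end NashPart


/-- **Existence of risk-averse Nash equilibria in action-dependent risk-averse matrix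
games.**  If each penalty function `D_i : P_{−i} × P_{−i} → ℝ` is jointly continuous and
convex in its first argument for each fixed second argument, then the `n`-player
action-dependent risk-averse game admits a joint strategy `π* ∈ P` such that no player
can decrease its risk-averse loss `f_i` by unilaterally deviating. -/
theorem exists_risk_averse_nash_action_dependent
    (n : ℕ) (hn : 2 ≤ n) (A : Fin n → ℕ) (hA : ∀ i, 1 ≤ A i)
    (R : ∀ i : Fin n, Fin (A i) → OppIdx n A i → ℝ)
    (D : ∀ i : Fin n, OppProfile n A i → OppProfile n A i → ℝ)
    (hDcont : ∀ i, ContinuousOn (fun q : OppProfile n A i × OppProfile n A i => D i q.1 q.2)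
      (OppSimplex n A i ×ˢ OppSimplex n A i))
    (hDconv : ∀ i, ∀ q ∈ OppSimplex n A i,
      ConvexOn ℝ (OppSimplex n A i) (fun p => D i p q)) :
    ∃ π : ∀ j, Fin (A j) → ℝ,
      (∀ j, π j ∈ stdSimplex ℝ (Fin (A j))) ∧
      ∀ i : Fin n, ∀ x ∈ stdSimplex ℝ (Fin (A i)),
        actLoss n A R D i π ≤ actLoss n A R D i (Function.update π i x) := by
  obtain ⟨π, hπ, h⟩ := sc_nash n hn A hA
    (fun i a π => sSup ((fun p => -(rowPair n A i (R i a) p) - D i p (restr n A π i)) ''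
      OppSimplex n A i)) (fun i a => sc_costCont n A i (R i a) (D i) (hDcont i))
  refine ⟨π, hπ, fun i x hx => ?_⟩
  have hr : restr n A (Function.update π i x) i = restr n A π i := by
    funext j
    exact Function.update_of_ne j.2 _ _
  have := h i x hx
  simpa only [actLoss, hr, Function.update_self] using this
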